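/- Contraction of the safe and risky Bellman operators: consider a balanced MDP and let α ∈ (0,1). For mode ∈ {safe, risky} and all Q₁, Q̃₁ : X×A → ℝ, ‖T^mode_α Q₁ − T^mode_α Q̃₁‖_∞ ≤ γ ‖Q₁ − Q̃₁‖_∞, where ‖·‖_∞ is the sup norm over X×A. -/

import Mathlib

open MeasureTheory ProbabilityTheory Finset Set

noncomputable section

/-- Quantile (generalized inverse distribution) function of a measure on `ℝ`. -/
def quantileFn (ν : Measure ℝ) (τ : ℝ) : ℝ :=
  sInf {z : ℝ | τ ≤ cdf ν z}

/-- Left average value-at-risk at level `α`. -/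
def avarLeft (α : ℝ) (ν : Measure ℝ) : ℝ :=
  (1 / α) * ∫ τ in (0:ℝ)..α, quantileFn ν τ

/-- Right average value-at-risk at level `1 - α`. -/
def avarRight (α : ℝ) (ν : Measure ℝ) : ℝ :=
  (1 / (1 - α)) * ∫ τ in α..(1:ℝ), quantileFn ν τ

/-- A measure on `ℝ` with bounded support. -/
def HasBoundedSupport (ν : Measure ℝ) : Prop :=
  ∃ a b : ℝ, ν (Set.Icc a b)ᶜ = 0

/-- Finite Markov decision process with fixed state and action spaces. -/
structure MDP (X A : Type) [Fintype X] [Fintype A] where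
  P : X → A → X → ℝ
  r : X → A → X → ℝ
  γ : ℝ
  P_nonneg : ∀ x a x', 0 ≤ P x a x'
  P_sum_one : ∀ x a, ∑ x', P x a x' = 1
  γ_nonneg : 0 ≤ γ
  γ_lt_one : γ < 1

variable {X A : Type} [Fintype X] [Fintype A]

/-- A stationary Markovian policy. -/
def IsPolicy (π : X → A → ℝ) : Prop :=
  (∀ x a, 0 ≤ π x a) ∧ ∀ x, ∑ a, π x a = 1

/-- The discrete measure `(T^π D_{α,Q})^{(x,a)}`. -/
def diatomicMeasure (M : MDP X A) (α : ℝ) (π : X → A → ℝ)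
    (Q : X → A → ℝ × ℝ) (x : X) (a : A) : Measure ℝ :=
  ∑ x' : X, ∑ a' : A, ENNReal.ofReal (M.P x a x' * π x' a') •
    (ENNReal.ofReal α • Measure.dirac (M.r x a x' + M.γ * (Q x' a').1)
      + ENNReal.ofReal (1 - α) • Measure.dirac (M.r x a x' + M.γ * (Q x' a').2))

/-- The diatomic Bellman operator `T^π_α`. -/
def diatomicT (M : MDP X A) (α : ℝ) (π : X → A → ℝ)
    (Q : X → A → ℝ × ℝ) : X → A → ℝ × ℝ :=
  fun x a => (avarLeft α (diatomicMeasure M α π Q x a),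
              avarRight α (diatomicMeasure M α π Q x a))

variable [Nonempty A]

/-- The second component `Q₂` determined by `Q₁` in a balanced MDP. -/
def Q2of (α : ℝ) (Vstar : X → ℝ) (Q1 : X → A → ℝ) : X → A → ℝ :=
  fun x a => (Vstar x - α * Q1 x a) / (1 - α)

/-- The MDP is balanced: `Q^*(x,a) = V^*(x)` for all `(x,a)`, i.e. `V^*` solves the
Bellman optimality equation with all actions optimal. -/
def IsBalanced (M : MDP X A) (Vstar : X → ℝ) : Prop :=
  ∀ x a, Vstar x = ∑ x', M.P x a x' * (M.r x a x' + M.γ * Vstar x')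

/-- The discrete measure appearing in the safe Bellman operator. -/
def safeMeasure (M : MDP X A) (α : ℝ) (Vstar : X → ℝ) (Q1 : X → A → ℝ)
    (x : X) (a : A) : Measure ℝ :=
  ∑ x' : X, ENNReal.ofReal (M.P x a x') •
    (ENNReal.ofReal α • Measure.dirac (M.r x a x' + M.γ * ⨆ a', Q1 x' a')
      + ENNReal.ofReal (1 - α) •
          Measure.dirac (M.r x a x' + M.γ * ⨅ a', Q2of α Vstar Q1 x' a'))

/-- The discrete measure appearing in the risky Bellman operator. -/
def riskyMeasure (M : MDP X A) (α : ℝ) (Vstar : X → ℝ) (Q1 : X → A → ℝ)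
    (x : X) (a : A) : Measure ℝ :=
  ∑ x' : X, ENNReal.ofReal (M.P x a x') •
    (ENNReal.ofReal α • Measure.dirac (M.r x a x' + M.γ * ⨅ a', Q1 x' a')
      + ENNReal.ofReal (1 - α) •
          Measure.dirac (M.r x a x' + M.γ * ⨆ a', Q2of α Vstar Q1 x' a'))

/-- The safe Bellman operator `T^safe_α`. -/
def Tsafe (M : MDP X A) (α : ℝ) (Vstar : X → ℝ) (Q1 : X → A → ℝ) : X → A → ℝ :=
  fun x a => avarLeft α (safeMeasure M α Vstar Q1 x a)

/-- The risky Bellman operator `T^risky_α`. -/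
def Trisky (M : MDP X A) (α : ℝ) (Vstar : X → ℝ) (Q1 : X → A → ℝ) : X → A → ℝ :=
  fun x a => avarLeft α (riskyMeasure M α Vstar Q1 x a)

/-- Supremum norm over `X × A`. -/
def qSupNorm [Nonempty X] (Q : X → A → ℝ) : ℝ :=
  ⨆ p : X × A, |Q p.1 p.2|

/-- The mixture, with weights `p`, of two-point laws with weights `α` and `1 - α`. -/
def twoPointMixture (p : X → ℝ) (α : ℝ) (y w : X → ℝ) : Measure ℝ :=
  ∑ x : X, ENNReal.ofReal (p x) •
    (ENNReal.ofReal α • Measure.dirac (y x) + ENNReal.ofReal (1 - α) • Measure.dirac (w x))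

theorem quantileFn_le_iff (ν : Measure ℝ) [IsProbabilityMeasure ν] {τ : ℝ}
    (hτ : τ ∈ Ioo (0 : ℝ) 1) (z : ℝ) : quantileFn ν τ ≤ z ↔ τ ≤ cdf ν z := by
  have hne : {z : ℝ | τ ≤ cdf ν z}.Nonempty :=
    ((tendsto_cdf_atTop ν).eventually (eventually_ge_nhds hτ.2)).exists
  have hbdd : BddBelow {z : ℝ | τ ≤ cdf ν z} := by
    obtain ⟨b, hb⟩ := ((tendsto_cdf_atBot ν).eventually (eventually_lt_nhds hτ.1)).exists
    refine ⟨b, fun z hz => ?_⟩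
    by_contra h
    exact absurd (hz.trans (monotone_cdf ν (not_le.mp h).le)) (not_le.mpr hb)
  refine ⟨fun h => ?_, fun h => csInf_le hbdd h⟩
  refine le_trans ?_ (monotone_cdf ν h)
  have hright : Filter.Tendsto (cdf ν) (nhdsWithin (quantileFn ν τ) (Ioi (quantileFn ν τ)))
      (nhds (cdf ν (quantileFn ν τ))) :=
    ((cdf ν).right_continuous _).mono_left (nhdsWithin_mono _ Ioi_subset_Ici_self)
  refine ge_of_tendsto hright ?_
  filter_upwards [self_mem_nhdsWithin] with u hu
  obtain ⟨s, hs, hsu⟩ := exists_lt_of_csInf_lt hne hu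
  exact le_trans hs (monotone_cdf ν hsu.le)

theorem monotoneOn_quantileFn (ν : Measure ℝ) [IsProbabilityMeasure ν] :
    MonotoneOn (quantileFn ν) (Ioo 0 1) := fun _ hs _ ht hst =>
  (quantileFn_le_iff ν hs _).2 (hst.trans ((quantileFn_le_iff ν ht _).1 le_rfl))

theorem aemeasurable_quantileFn (ν : Measure ℝ) [IsProbabilityMeasure ν] :
    AEMeasurable (quantileFn ν) (volume.restrict (Ioo 0 1)) :=
  aemeasurable_restrict_of_monotoneOn measurableSet_Ioo (monotoneOn_quantileFn ν)

/-- The quantile function of `ν` pushes the uniform law on `(0, 1)` forward to `ν`. -/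
theorem map_quantileFn (ν : Measure ℝ) [IsProbabilityMeasure ν] :
    (volume.restrict (Ioo (0 : ℝ) 1)).map (quantileFn ν) = ν := by
  have : IsProbabilityMeasure (volume.restrict (Ioo (0 : ℝ) 1)) := ⟨by simp⟩
  have := Measure.isProbabilityMeasure_map (aemeasurable_quantileFn ν)
  refine Measure.ext_of_Iic _ _ fun z => ?_
  rw [Measure.map_apply_of_aemeasurable (aemeasurable_quantileFn ν) measurableSet_Iic,
    Measure.restrict_apply' measurableSet_Ioo, ← ofReal_cdf ν z]
  have hset : quantileFn ν ⁻¹' Iic z ∩ Ioo 0 1 = Iic (cdf ν z) ∩ Ioo 0 1 := by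
    ext τ
    simp only [Set.mem_inter_iff, Set.mem_preimage, Set.mem_Iic]
    exact and_congr_left fun h => quantileFn_le_iff ν h z
  have h0 := cdf_nonneg ν z
  have h1 := cdf_le_one ν z
  rw [hset]
  refine le_antisymm ?_ ?_
  · calc volume (Iic (cdf ν z) ∩ Ioo 0 1) ≤ volume (Ioc 0 (cdf ν z)) :=
          measure_mono fun _ hτ => ⟨hτ.2.1, hτ.1⟩
      _ = _ := by simp
  · calc ENNReal.ofReal (cdf ν z) = volume (Ioo 0 (cdf ν z)) := by simp
      _ ≤ volume (Iic (cdf ν z) ∩ Ioo 0 1) :=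
          measure_mono fun _ hτ => ⟨hτ.2.le, hτ.1, hτ.2.trans_le h1⟩

theorem integrableOn_quantileFn (ν : Measure ℝ) [IsProbabilityMeasure ν]
    (hν : Integrable id ν) : IntegrableOn (quantileFn ν) (Ioo 0 1) := by
  rw [← map_quantileFn ν] at hν
  exact (integrable_map_measure measurable_id.aestronglyMeasurable
    (aemeasurable_quantileFn ν)).1 hν

/-- The Rockafellar–Uryasev variational formula for the lower tail of the quantile function. -/
theorem isGreatest_intervalIntegral_quantileFn (ν : Measure ℝ) [IsProbabilityMeasure ν]
    (hν : Integrable id ν) {α : ℝ} (hα : α ∈ Ioo (0 : ℝ) 1) :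
    IsGreatest (Set.range fun z => α * z - ∫ y, max (z - y) 0 ∂ν)
      (∫ τ in (0 : ℝ)..α, quantileFn ν τ) := by
  have hint := integrableOn_quantileFn ν hν
  have hsub : Ioc 0 α ⊆ Ioo (0 : ℝ) 1 := fun τ hτ => ⟨hτ.1, hτ.2.trans_lt hα.2⟩
  have htail (z : ℝ) : ∫ y, max (z - y) 0 ∂ν
      = ∫ τ in Ioo (0 : ℝ) 1, max (z - quantileFn ν τ) 0 := by
    conv_lhs => rw [← map_quantileFn ν]
    exact integral_map (aemeasurable_quantileFn ν)
      (by fun_prop : Measurable fun y : ℝ => max (z - y) 0).aestronglyMeasurable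
  have hintz (z : ℝ) : IntegrableOn (fun τ => z - quantileFn ν τ) (Ioo 0 1) :=
    (integrableOn_const (by simp)).sub hint
  have hlow (z : ℝ) : α * z - ∫ τ in (0 : ℝ)..α, quantileFn ν τ
      = ∫ τ in Ioc 0 α, (z - quantileFn ν τ) := by
    rw [intervalIntegral.integral_of_le hα.1.le,
      integral_sub (integrable_const z) (hint.mono_set hsub)]
    simp [hα.1.le]
  constructor
  · refine ⟨quantileFn ν α, ?_⟩
    have h := hlow (quantileFn ν α)
    have : ∫ τ in Ioo (0 : ℝ) 1, max (quantileFn ν α - quantileFn ν τ) 0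
        = ∫ τ in Ioc 0 α, (quantileFn ν α - quantileFn ν τ) := by
      rw [setIntegral_eq_of_subset_of_forall_sdiff_eq_zero measurableSet_Ioo hsub]
      · refine setIntegral_congr_fun measurableSet_Ioc fun τ hτ => max_eq_left ?_
        exact sub_nonneg.2 (monotoneOn_quantileFn ν (hsub hτ) hα hτ.2)
      · intro τ hτ
        refine max_eq_right (sub_nonpos.2 (monotoneOn_quantileFn ν hα hτ.1 ?_))
        by_contra hlt
        exact hτ.2 ⟨hτ.1.1, (not_le.mp hlt).le⟩
    simp only [htail, this]
    linarith
  · rintro _ ⟨z, rfl⟩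
    have h := hlow z
    have h1 : ∫ τ in Ioc 0 α, (z - quantileFn ν τ)
        ≤ ∫ τ in Ioc 0 α, max (z - quantileFn ν τ) 0 :=
      integral_mono ((hintz z).mono_set hsub) ((hintz z).mono_set hsub).pos_part
        fun τ => le_max_left _ _
    have h2 : ∫ τ in Ioc 0 α, max (z - quantileFn ν τ) 0
        ≤ ∫ τ in Ioo (0 : ℝ) 1, max (z - quantileFn ν τ) 0 :=
      setIntegral_mono_set (hintz z).pos_part
        (Filter.Eventually.of_forall fun τ => le_max_right _ _) hsub.eventuallyLE
    simp only [htail]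
    linarith

theorem isProbabilityMeasure_twoPointMixture {p : X → ℝ} (hp : ∀ x, 0 ≤ p x)
    (hp1 : ∑ x, p x = 1) {α : ℝ} (hα : α ∈ Ioo (0 : ℝ) 1) (y w : X → ℝ) :
    IsProbabilityMeasure (twoPointMixture p α y w) := by
  constructor
  have h : ENNReal.ofReal α + ENNReal.ofReal (1 - α) = 1 := by
    rw [← ENNReal.ofReal_add hα.1.le (sub_nonneg.2 hα.2.le)]
    simp
  simp [twoPointMixture, Measure.finsetSum_apply, ← mul_add, h,
    ← ENNReal.ofReal_sum_of_nonneg fun x _ => hp x, hp1]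

theorem integrable_twoPointMixture (p : X → ℝ) (α : ℝ) (y w : X → ℝ) (f : ℝ → ℝ) :
    Integrable f (twoPointMixture p α y w) := by
  have hd (a : ℝ) : Integrable f (Measure.dirac a) :=
    integrable_dirac (by simp)
  refine integrable_finsetSum_measure.2 fun x _ => ?_
  exact (((hd _).smul_measure (by simp)).add_measure
    ((hd _).smul_measure (by simp))).smul_measure (by simp)

theorem integral_twoPointMixture {p : X → ℝ} (hp : ∀ x, 0 ≤ p x) {α : ℝ}
    (hα : α ∈ Ioo (0 : ℝ) 1) (y w : X → ℝ) (f : ℝ → ℝ) :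
    ∫ t, f t ∂twoPointMixture p α y w
      = ∑ x, p x * (α * f (y x) + (1 - α) * f (w x)) := by
  have hd (a : ℝ) : Integrable f (Measure.dirac a) :=
    integrable_dirac (by simp)
  have hi (x : X) := ((hd (y x)).smul_measure (c := ENNReal.ofReal α) (by simp)).add_measure
    ((hd (w x)).smul_measure (c := ENNReal.ofReal (1 - α)) (by simp))
  rw [twoPointMixture, integral_finsetSum_measure fun x _ => (hi x).smul_measure (by simp)]
  refine Finset.sum_congr rfl fun x _ => ?_
  rw [integral_smul_measure, integral_add_measure ((hd _).smul_measure (by simp))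
    ((hd _).smul_measure (by simp)), integral_smul_measure, integral_smul_measure,
    integral_dirac, integral_dirac, ENNReal.toReal_ofReal (hp x),
    ENNReal.toReal_ofReal hα.1.le, ENNReal.toReal_ofReal (sub_nonneg.2 hα.2.le)]
  simp only [smul_eq_mul]

/-- Moving the first atom by at most `d`, and the second so that the mean is preserved, raises
the expected shortfall below `z` by at most `α * d`. -/
theorem shortfall_le {α : ℝ} (hα : α ∈ Ioo (0 : ℝ) 1) {z y w y' w' d : ℝ}
    (hmean : α * y + (1 - α) * w = α * y' + (1 - α) * w') (hd : |y - y'| ≤ d) :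
    α * max (z - y) 0 + (1 - α) * max (z - w) 0
      ≤ α * max (z - y') 0 + (1 - α) * max (z - w') 0 + α * d := by
  have h1 : 0 < 1 - α := sub_pos.2 hα.2
  have h0 := hα.1
  have hmul (c : ℝ) {k : ℝ} (hk : 0 < k) : k * max c 0 = max (k * c) 0 := by
    rw [mul_max_of_nonneg _ _ hk.le, mul_zero]
  obtain ⟨hl, hu⟩ := abs_le.1 hd
  have hl' := mul_le_mul_of_nonneg_left hl h0.le
  have hu' := mul_le_mul_of_nonneg_left hu h0.le
  rw [hmul _ h0, hmul _ h0, hmul _ h1, hmul _ h1]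
  rcases max_cases (α * (z - y)) 0 with h | h <;> rcases max_cases (α * (z - y')) 0 with h2 | h2 <;>
  rcases max_cases ((1 - α) * (z - w)) 0 with h3 | h3 <;>
  rcases max_cases ((1 - α) * (z - w')) 0 with h4 | h4 <;> linarith

theorem avarLeft_twoPointMixture_sub_le {p : X → ℝ} (hp : ∀ x, 0 ≤ p x)
    (hp1 : ∑ x, p x = 1) {α : ℝ} (hα : α ∈ Ioo (0 : ℝ) 1) {y w y' w' : X → ℝ} {d : ℝ}
    (hmean : ∀ x, α * y x + (1 - α) * w x = α * y' x + (1 - α) * w' x)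
    (hd : ∀ x, |y x - y' x| ≤ d) :
    avarLeft α (twoPointMixture p α y w) - avarLeft α (twoPointMixture p α y' w') ≤ d := by
  have := isProbabilityMeasure_twoPointMixture hp hp1 hα y w
  have := isProbabilityMeasure_twoPointMixture hp hp1 hα y' w'
  obtain ⟨z, hz⟩ := (isGreatest_intervalIntegral_quantileFn _
    (integrable_twoPointMixture p α y w id) hα).1
  have hz' := (isGreatest_intervalIntegral_quantileFn _
    (integrable_twoPointMixture p α y' w' id) hα).2 ⟨z, rfl⟩
  simp only [integral_twoPointMixture hp hα] at hz hz'
  have hsum : ∑ x, p x * (α * max (z - y' x) 0 + (1 - α) * max (z - w' x) 0)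
      ≤ (∑ x, p x * (α * max (z - y x) 0 + (1 - α) * max (z - w x) 0)) + α * d := by
    rw [show α * d = ∑ x, p x * (α * d) by rw [← Finset.sum_mul, hp1, one_mul],
      ← Finset.sum_add_distrib]
    refine Finset.sum_le_sum fun x _ => ?_
    rw [← mul_add]
    refine mul_le_mul_of_nonneg_left (shortfall_le hα (hmean x).symm ?_) (hp x)
    rw [abs_sub_comm]
    exact hd x
  rw [avarLeft, avarLeft, ← mul_sub, one_div, inv_mul_le_iff₀ hα.1]
  linarith

theorem abs_avarLeft_twoPointMixture_sub_le {p : X → ℝ} (hp : ∀ x, 0 ≤ p x)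
    (hp1 : ∑ x, p x = 1) {α : ℝ} (hα : α ∈ Ioo (0 : ℝ) 1) {y w y' w' : X → ℝ} {d : ℝ}
    (hmean : ∀ x, α * y x + (1 - α) * w x = α * y' x + (1 - α) * w' x)
    (hd : ∀ x, |y x - y' x| ≤ d) :
    |avarLeft α (twoPointMixture p α y w) - avarLeft α (twoPointMixture p α y' w')| ≤ d :=
  abs_sub_le_iff.2 ⟨avarLeft_twoPointMixture_sub_le hp hp1 hα hmean hd,
    avarLeft_twoPointMixture_sub_le hp hp1 hα (fun x => (hmean x).symm)
      fun x => by rw [abs_sub_comm]; exact hd x⟩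

theorem antitone_Q2of_map {α : ℝ} (hα : α ∈ Ioo (0 : ℝ) 1) (v : ℝ) :
    Antitone fun q : ℝ => (v - α * q) / (1 - α) := fun _ _ h =>
  div_le_div_of_nonneg_right (sub_le_sub_left (mul_le_mul_of_nonneg_left h hα.1.le) v)
    (sub_nonneg.2 hα.2.le)

theorem iInf_Q2of {S B : Type} [Fintype B] [Nonempty B] {α : ℝ} (hα : α ∈ Ioo (0 : ℝ) 1)
    (Vstar : S → ℝ) (Q1 : S → B → ℝ) (x : S) :
    ⨅ a, Q2of α Vstar Q1 x a = (Vstar x - α * ⨆ a, Q1 x a) / (1 - α) :=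
  ((antitone_Q2of_map hα (Vstar x)).map_ciSup_of_continuousAt (by fun_prop)
    (Set.finite_range _).bddAbove).symm

theorem iSup_Q2of {S B : Type} [Fintype B] [Nonempty B] {α : ℝ} (hα : α ∈ Ioo (0 : ℝ) 1)
    (Vstar : S → ℝ) (Q1 : S → B → ℝ) (x : S) :
    ⨆ a, Q2of α Vstar Q1 x a = (Vstar x - α * ⨅ a, Q1 x a) / (1 - α) :=
  ((antitone_Q2of_map hα (Vstar x)).map_ciInf_of_continuousAt (by fun_prop)
    (Set.finite_range _).bddBelow).symm

theorem abs_iSup_sub_iSup_le {f g : A → ℝ} {d : ℝ} (h : ∀ a, |f a - g a| ≤ d) :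
    |(⨆ a, f a) - ⨆ a, g a| ≤ d := by
  refine abs_sub_le_iff.2 ⟨sub_le_iff_le_add.2 (ciSup_le fun a => ?_),
    sub_le_iff_le_add.2 (ciSup_le fun a => ?_)⟩
  · linarith [le_ciSup (Set.finite_range g).bddAbove a, (abs_le.1 (h a)).2]
  · linarith [le_ciSup (Set.finite_range f).bddAbove a, (abs_le.1 (h a)).1]

theorem abs_iInf_sub_iInf_le {f g : A → ℝ} {d : ℝ} (h : ∀ a, |f a - g a| ≤ d) :
    |(⨅ a, f a) - ⨅ a, g a| ≤ d := by
  refine abs_sub_le_iff.2 ⟨sub_le_comm.1 (le_ciInf fun a => ?_),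
    sub_le_comm.1 (le_ciInf fun a => ?_)⟩
  · linarith [ciInf_le (Set.finite_range f).bddBelow a, (abs_le.1 (h a)).2]
  · linarith [ciInf_le (Set.finite_range g).bddBelow a, (abs_le.1 (h a)).1]

theorem abs_le_qSupNorm {S B : Type} [Fintype S] [Fintype B] [Nonempty S] (Q : S → B → ℝ)
    (x : S) (a : B) : |Q x a| ≤ qSupNorm Q :=
  le_ciSup (f := fun p : S × B => |Q p.1 p.2|) (Set.finite_range _).bddAbove (x, a)

/-- One-step backups whose two atoms are tied together by the mean `Vstar` depend on the first
atom in a `γ`-Lipschitz way. -/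
theorem abs_avarLeft_backup_sub_le {S B : Type} [Fintype S] [Fintype B] (M : MDP S B) {α : ℝ}
    (hα : α ∈ Ioo (0 : ℝ) 1) (Vstar : S → ℝ) {m m' : S → ℝ} {d : ℝ} (hd : ∀ x, |m x - m' x| ≤ d)
    (x : S) (a : B) :
    |avarLeft α (twoPointMixture (M.P x a) α (fun x' => M.r x a x' + M.γ * m x')
        fun x' => M.r x a x' + M.γ * ((Vstar x' - α * m x') / (1 - α)))
      - avarLeft α (twoPointMixture (M.P x a) α (fun x' => M.r x a x' + M.γ * m' x')
        fun x' => M.r x a x' + M.γ * ((Vstar x' - α * m' x') / (1 - α)))| ≤ M.γ * d := by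
  have h1 : 1 - α ≠ 0 := (sub_pos.2 hα.2).ne'
  refine abs_avarLeft_twoPointMixture_sub_le (M.P_nonneg x a) (M.P_sum_one x a) hα
    (fun x' => ?_) fun x' => ?_
  · field_simp
    ring
  · rw [add_sub_add_left_eq_sub, ← mul_sub, abs_mul, abs_of_nonneg M.γ_nonneg]
    exact mul_le_mul_of_nonneg_left (hd x') M.γ_nonneg

theorem stmt15 [Nonempty X] (M : MDP X A) (α : ℝ) (hα : α ∈ Set.Ioo (0:ℝ) 1)
    (Vstar : X → ℝ) (hbal : IsBalanced M Vstar)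
    (Q1 Qt1 : X → A → ℝ) :
    qSupNorm (fun x a => Tsafe M α Vstar Q1 x a - Tsafe M α Vstar Qt1 x a) ≤
      M.γ * qSupNorm (fun x a => Q1 x a - Qt1 x a) ∧
    qSupNorm (fun x a => Trisky M α Vstar Q1 x a - Trisky M α Vstar Qt1 x a) ≤
      M.γ * qSupNorm (fun x a => Q1 x a - Qt1 x a) := by
  have hle := abs_le_qSupNorm fun x a => Q1 x a - Qt1 x a
  constructor
  · refine ciSup_le fun p => ?_
    simp only [Tsafe, safeMeasure, iInf_Q2of hα]
    exact abs_avarLeft_backup_sub_le M hα Vstar (fun x => abs_iSup_sub_iSup_le (hle x)) p.1 p.2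
  · refine ciSup_le fun p => ?_
    simp only [Trisky, riskyMeasure, iSup_Q2of hα]
    exact abs_avarLeft_backup_sub_le M hα Vstar (fun x => abs_iInf_sub_iInf_le (hle x)) p.1 p.2

end
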